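/- Let J ∈ B(H) be an anti self-adjoint unitary operator on H = ℓ²(ℕ, ℍ) and m ∈ 𝕊. Then the slice Hilbert space H_+^{Jm} is a separable Hilbert space over ℂ_m: it possesses a countable orthonormal basis. -/

import Mathlib

noncomputable section

open Quaternion Filter Topology

/-- The division ring `ℍ` of real quaternions. -/
abbrev Hq := Quaternion ℝ

/-- The quaternionic Hilbert space `H = ℓ²(ℕ, ℍ)`. -/
abbrev Hsp := lp (fun _ : ℕ => Hq) 2

/-- Right scalar multiplication `x ↦ x · q` on `ℓ²(ℕ, ℍ)` (coordinatewise right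
multiplication by the quaternion `q`). -/
def rsmul (q : Hq) (x : Hsp) : Hsp := MulOpposite.op q • x

/-- The quaternionic inner product `⟨x, y⟩ = ∑ₙ x̄ₙ yₙ`. -/
def qinner (x y : Hsp) : Hq := ∑' n, star (x n) * y n

/-- The set `𝕊` of unit imaginary quaternions. -/
def QS : Set Hq := {q | star q = -q ∧ ‖q‖ = 1}

/-- The slice complex plane `ℂ_m = {α + mβ : α, β ∈ ℝ}`. -/
def sliceC (m : Hq) : Set Hq := {q | ∃ α β : ℝ, q = (α : Hq) + m * (β : Hq)}

/-- The closed upper half slice plane `ℂ_m⁺ = {α + mβ : α ∈ ℝ, β ≥ 0}`. -/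
def sliceCplus (m : Hq) : Set Hq :=
  {q | ∃ α β : ℝ, 0 ≤ β ∧ q = (α : Hq) + m * (β : Hq)}

/-- `T : H → H` is a bounded right linear operator, i.e. `T ∈ B(H)`. -/
def IsBoundedRightLinear (T : Hsp → Hsp) : Prop :=
  (∀ x y, T (x + y) = T x + T y) ∧ (∀ q x, T (rsmul q x) = rsmul q (T x)) ∧
    ∃ M : ℝ, ∀ x, ‖T x‖ ≤ M * ‖x‖

/-- `S` is the adjoint of the (bounded) operator `T`: `⟨y, Tx⟩ = ⟨Sy, x⟩` for all `x, y`. -/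
def AdjointOf (T S : Hsp → Hsp) : Prop := ∀ x y, qinner y (T x) = qinner (S y) x

/-- `T` is anti self-adjoint: `T* = -T`. -/
def IsAntiSelfAdjoint (T : Hsp → Hsp) : Prop := AdjointOf T (fun x => -(T x))

/-- `T` is unitary: `T*T = TT* = I`. -/
def IsUnitaryOp (T : Hsp → Hsp) : Prop :=
  ∃ S, AdjointOf T S ∧ (∀ x, S (T x) = x) ∧ (∀ x, T (S x) = x)

/-- The slice Hilbert space `H₊^{Jm} = {u ∈ H : Ju = um}`. -/
def Hplus (J : Hsp → Hsp) (m : Hq) : Set Hsp := {u | J u = rsmul m u}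

/-- `H₋^{Jm} = {u ∈ H : Ju = -um}`. -/
def Hminus (J : Hsp → Hsp) (m : Hq) : Set Hsp := {u | J u = -(rsmul m u)}

/-- `e` is an orthonormal basis of the (closed subspace given by the) set `S`:
each `e r` lies in `S`, the `e r` are orthonormal, and every `x ∈ S` expands as
`x = ∑ᵣ (e r) ⟨e r, x⟩`. Taking `S = Set.univ` gives orthonormal bases of `H`. -/
def IsONBasisOn (S : Set Hsp) (e : ℕ → Hsp) : Prop :=
  (∀ r, e r ∈ S) ∧ (∀ r s, qinner (e r) (e s) = if r = s then 1 else 0) ∧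
    ∀ x ∈ S, HasSum (fun r => rsmul (qinner (e r) x) (e r)) x

/-- A (possibly unbounded) operator in `H`: a domain together with an assignment of
values (only the values on the domain are relevant). -/
structure QOp where
  dom : Set Hsp
  app : Hsp → Hsp

/-- The operator `T` is right linear: its domain is a right `ℍ`-submodule and `T`
is additive and right `ℍ`-homogeneous on it. -/
def QOp.IsRightLinear (T : QOp) : Prop :=
  (0 ∈ T.dom) ∧
  (∀ x ∈ T.dom, ∀ y ∈ T.dom, x + y ∈ T.dom ∧ T.app (x + y) = T.app x + T.app y) ∧
  (∀ x ∈ T.dom, ∀ q : Hq, rsmul q x ∈ T.dom ∧ T.app (rsmul q x) = rsmul q (T.app x))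

/-- `T` is densely defined. -/
def QOp.IsDenselyDefined (T : QOp) : Prop := Dense T.dom

/-- `T` is a closed operator: its graph is closed in `H × H`. -/
def QOp.IsClosedOp (T : QOp) : Prop :=
  IsClosed {p : Hsp × Hsp | p.1 ∈ T.dom ∧ p.2 = T.app p.1}

/-- `S` is the adjoint `T*` of `T`: the domain of `S` is
`{y : x ↦ ⟨y, Tx⟩ is continuous on D(T)}` and `⟨y, Tx⟩ = ⟨Sy, x⟩` there. -/
def QOp.IsAdjointOf (T S : QOp) : Prop :=
  S.dom = {y | ContinuousOn (fun x => qinner y (T.app x)) T.dom} ∧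
  ∀ y ∈ S.dom, ∀ x ∈ T.dom, qinner y (T.app x) = qinner (S.app y) x

/-- Composition `S ∘ T` of partial operators, with the natural domain. -/
def QOp.comp (S T : QOp) : QOp :=
  ⟨{x ∈ T.dom | T.app x ∈ S.dom}, fun x => S.app (T.app x)⟩

/-- Equality of partial operators: equal domains and equal values on the domain. -/
def QOp.Eq (A B : QOp) : Prop := A.dom = B.dom ∧ ∀ x ∈ A.dom, A.app x = B.app x

/-- `T` is normal: `T*T = TT*` (including equality of the domains). -/
def QOp.IsNormal (T : QOp) : Prop :=
  ∃ S : QOp, T.IsAdjointOf S ∧ QOp.Eq (S.comp T) (T.comp S)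

/-- `T` is compact (as an operator on the subspace `S` of `H`): the image of the
closed unit ball of `S` is relatively compact. -/
def IsCompactOn (T : Hsp → Hsp) (S : Set Hsp) : Prop :=
  IsCompact (closure (T '' (Metric.closedBall 0 1 ∩ S)))

/-- `T` has squared Hilbert–Schmidt norm `v` on the subspace `S`:
`∑ᵣ ‖T eᵣ‖² = v` for some orthonormal basis `e` of `S`. -/
def HasHSNormSqOn (T : Hsp → Hsp) (S : Set Hsp) (v : ℝ) : Prop :=
  ∃ e : ℕ → Hsp, IsONBasisOn S e ∧ HasSum (fun r => ‖T (e r)‖ ^ 2) v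

/-- `T` is diagonal: there are an orthonormal basis `{φᵣ}` of `H` contained in `D(T)`
and quaternions `qᵣ` with `Tφᵣ = φᵣ qᵣ`. -/
def QOp.IsDiagonal (T : QOp) : Prop :=
  ∃ e : ℕ → Hsp, IsONBasisOn Set.univ e ∧ (∀ r, e r ∈ T.dom) ∧
    ∃ q : ℕ → Hq, ∀ r, T.app (e r) = rsmul (q r) (e r)

/-- The operator `Δ_q(N) = N² - N(q + q̄) + I|q|²` for a bounded operator `N`. -/
def sphDeltaB (N : Hsp → Hsp) (q : Hq) : Hsp → Hsp :=
  fun x => N (N x) - rsmul (q + star q) (N x) + rsmul ((normSq q : ℝ) : Hq) x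

/-- `q` lies in the spherical resolvent of the bounded operator `N`. -/
def inSphResolventB (N : Hsp → Hsp) (q : Hq) : Prop :=
  (∀ x, sphDeltaB N q x = 0 → x = 0) ∧
  Dense (Set.range (sphDeltaB N q)) ∧
  ∃ M : ℝ, ∀ x, ‖x‖ ≤ M * ‖sphDeltaB N q x‖

/-- The spherical spectrum of a bounded operator. -/
def sphSpectrumB (N : Hsp → Hsp) : Set Hq := {q | ¬ inSphResolventB N q}

/-- The domain `D(N²)` of the square of a partial operator. -/
def QOp.sqDom (N : QOp) : Set Hsp := {x ∈ N.dom | N.app x ∈ N.dom}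

/-- The map underlying `Δ_q(N) = N² - N(q + q̄) + I|q|²`, defined on `D(N²)`. -/
def sphDeltaU (N : QOp) (q : Hq) : Hsp → Hsp :=
  fun x => N.app (N.app x) - rsmul (q + star q) (N.app x) + rsmul ((normSq q : ℝ) : Hq) x

/-- `q` lies in the spherical resolvent of the operator `N ∈ C(H)`. -/
def inSphResolventU (N : QOp) (q : Hq) : Prop :=
  (∀ x ∈ N.sqDom, sphDeltaU N q x = 0 → x = 0) ∧
  Dense (sphDeltaU N q '' N.sqDom) ∧
  ∃ M : ℝ, ∀ x ∈ N.sqDom, ‖x‖ ≤ M * ‖sphDeltaU N q x‖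

/-- The spherical spectrum of `N ∈ C(H)`. -/
def sphSpectrumU (N : QOp) : Set Hq := {q | ¬ inSphResolventU N q}

/-- The circularization `Ω_K = {α + jβ : α + mβ ∈ K, j ∈ 𝕊}` of `K ⊆ ℂ_m`. -/
def circ (m : Hq) (K : Set Hq) : Set Hq :=
  {p | ∃ α β : ℝ, ∃ j ∈ QS, ((α : Hq) + m * (β : Hq) ∈ K) ∧ p = (α : Hq) + j * (β : Hq)}

/-- The complex Hilbert space structure on a real inner product space given by an orthogonal
complex structure `I`: scalars act by `(α + iβ) • x = α x + β (I x)`. -/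
abbrev innerProductSpaceOfComplexStructure {E : Type*} [NormedAddCommGroup E]
    [InnerProductSpace ℝ E] (I : E →ₗ[ℝ] E) (hI : ∀ x, I (I x) = -x)
    (hinner : ∀ x y, inner ℝ (I x) (I y) = inner ℝ x y) : InnerProductSpace ℂ E :=
  let φ : ℂ →ₐ[ℝ] Module.End ℝ E := Complex.lift ⟨I, by ext x; simp [hI]⟩
  have hφ : ∀ (z : ℂ) (x : E), φ z x = z.re • x + z.im • I x := fun z x => by
    simp [φ, Complex.liftAux_apply, Module.algebraMap_end_apply]
  have hskew : ∀ x y, inner ℝ (I x) y = -inner ℝ x (I y) := fun x y => by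
    rw [← hinner x (I y), hI, inner_neg_right, neg_neg]
  have hself : ∀ x, inner ℝ (I x) x = 0 := fun x => by
    have h := hskew x x
    rw [real_inner_comm (I x) x] at h
    linarith
  { Module.compHom E φ.toRingHom with
    norm_smul_le := fun z x => by
      refine le_of_eq ?_
      change ‖φ z x‖ = _
      rw [hφ]
      refine (sq_eq_sq₀ (norm_nonneg _) (by positivity)).1 ?_
      rw [mul_pow, ← Complex.normSq_eq_norm_sq, Complex.normSq_apply,
        ← real_inner_self_eq_norm_sq, ← real_inner_self_eq_norm_sq]
      simp only [inner_add_left, inner_add_right, real_inner_smul_left, real_inner_smul_right,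
        hinner, real_inner_comm (I x) x, hself]
      ring
    inner := fun x y => ⟨inner ℝ x y, inner ℝ (I x) y⟩
    norm_sq_eq_re_inner := fun x => (real_inner_self_eq_norm_sq x).symm
    conj_inner_symm := fun x y => by
      apply Complex.ext
      · exact real_inner_comm _ _
      · change -inner ℝ (I y) x = inner ℝ (I x) y
        rw [hskew y x, neg_neg, real_inner_comm]
    add_left := fun x y z => by
      apply Complex.ext
      · exact inner_add_left _ _ _
      · change inner ℝ (I (x + y)) z = inner ℝ (I x) z + inner ℝ (I y) z
        rw [map_add, inner_add_left]
    smul_left := fun x y z => by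
      change (⟨inner ℝ (φ z x) y, inner ℝ (I (φ z x)) y⟩ : ℂ) = _
      apply Complex.ext <;>
        simp [hφ, hI, inner_add_left, real_inner_smul_left] }

/-- An orthonormal family in a separable inner product space is countable. -/
theorem Orthonormal.countable_of_separableSpace {𝕜 E ι : Type*} [RCLike 𝕜]
    [NormedAddCommGroup E] [InnerProductSpace 𝕜 E] [TopologicalSpace.SeparableSpace E]
    {v : ι → E} (hv : Orthonormal 𝕜 v) : Countable ι := by
  have hdist : ∀ i j, i ≠ j → 1 < dist (v i) (v j) := fun i j hij => by
    have h := norm_sub_sq (𝕜 := 𝕜) (v i) (v j)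
    rw [hv.2 hij, hv.1, hv.1] at h
    rw [dist_eq_norm]
    norm_num at h
    nlinarith [norm_nonneg (v i - v j)]
  refine Pairwise.countable_of_isOpen_disjoint (s := fun i => Metric.ball (v i) (1 / 2))
    (fun i j hij => Metric.ball_disjoint_ball ?_) (fun _ => Metric.isOpen_ball)
    (fun i => Metric.nonempty_ball.2 (by norm_num))
  have := hdist i j hij
  linarith

/-- A separable infinite-dimensional real Hilbert space with an orthogonal complex structure `I`
has a unitary basis indexed by `ℕ`. -/
theorem exists_unitary_basis_of_complexStructure {E : Type*} [NormedAddCommGroup E]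
    [InnerProductSpace ℝ E] [CompleteSpace E] [TopologicalSpace.SeparableSpace E]
    (I : E →ₗ[ℝ] E) (hI : ∀ x, I (I x) = -x)
    (hinner : ∀ x y, inner ℝ (I x) (I y) = inner ℝ x y) (hE : ¬ FiniteDimensional ℝ E) :
    ∃ e : ℕ → E, (∀ r s, inner ℝ (e r) (e s) = if r = s then 1 else 0) ∧
      (∀ r s, inner ℝ (I (e r)) (e s) = 0) ∧
      ∀ x, HasSum (fun r => inner ℝ (e r) x • e r + inner ℝ (I (e r)) x • I (e r)) x := by
  let _ : InnerProductSpace ℂ E := innerProductSpaceOfComplexStructure I hI hinner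
  have hsmul : ∀ (z : ℂ) (x : E), z • x = z.re • x + z.im • I x := fun z x => by
    change (Complex.lift ⟨I, _⟩ : ℂ →ₐ[ℝ] Module.End ℝ E) z x = _
    simp [Complex.liftAux_apply, Module.algebraMap_end_apply]
  have hin : ∀ x y : E, inner ℂ x y = ⟨inner ℝ x y, inner ℝ (I x) y⟩ := fun _ _ => rfl
  obtain ⟨w, b, -⟩ := exists_hilbertBasis ℂ E
  have hcount : Countable w := b.orthonormal.countable_of_separableSpace
  have hinf : Infinite w := by
    by_contra hfin
    rw [not_infinite_iff_finite] at hfin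
    have := Fintype.ofFinite w
    refine hE (FiniteDimensional.of_injective
      (LinearMap.pi fun i => (innerₛₗ ℝ (b i)).prod (innerₛₗ ℝ (I (b i))) :
        E →ₗ[ℝ] w → ℝ × ℝ) ?_)
    rw [← LinearMap.ker_eq_bot, LinearMap.ker_eq_bot']
    intro x hx
    refine (b.hasSum_repr x).unique ?_
    convert hasSum_zero (α := E) (β := w) with i
    have hxi := congrFun hx i
    have h₁ : inner ℝ (b i) x = 0 := congrArg Prod.fst hxi
    have h₂ : inner ℝ (I (b i)) x = 0 := congrArg Prod.snd hxi
    rw [b.repr_apply_apply, hin, hsmul]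
    simp [h₁, h₂]
  obtain ⟨σ⟩ := nonempty_equiv_of_countable (α := ℕ) (β := w)
  have hon : ∀ r s,
      (⟨inner ℝ (b (σ r)) (b (σ s)), inner ℝ (I (b (σ r))) (b (σ s))⟩ : ℂ) =
        if r = s then 1 else 0 := fun r s => by
    classical
    rw [← hin, orthonormal_iff_ite.1 b.orthonormal]
    simp
  refine ⟨fun r => b (σ r), fun r s => ?_, fun r s => ?_, fun x => ?_⟩
  · have := congrArg Complex.re (hon r s)
    dsimp only at this
    rw [this]; split_ifs <;> rfl
  · have := congrArg Complex.im (hon r s)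
    dsimp only at this
    rw [this]; split_ifs <;> rfl
  · convert σ.hasSum_iff.2 (b.hasSum_repr x) with r
    simp only [Function.comp, b.repr_apply_apply, hin, hsmul]

namespace Quaternion

theorem re_mul_comm (p q : Hq) : (p * q).re = (q * p).re := by
  simp only [re_mul]
  ring

theorem mul_self_of_mem_QS {m : Hq} (hm : m ∈ QS) : m * m = -1 := by
  have h : star m * m = 1 := by
    rw [star_mul_self, normSq_eq_norm_mul_self, hm.2]
    simp
  rw [hm.1, neg_mul] at h
  rw [← h, neg_neg]

/-- The commutant of `m ∈ 𝕊` is the slice plane `ℂ_m`. -/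
theorem eq_re_add_mul_of_commute {m q : Hq} (hm : m ∈ QS) (h : m * q = q * m) :
    q = (q.re : Hq) + m * ((star m * q).re : Hq) := by
  have hre : m.re = 0 := by
    have := congrArg QuaternionAlgebra.re hm.1
    simp only [re_star, re_neg] at this
    linarith
  have hsq := congrArg QuaternionAlgebra.re (mul_self_of_mem_QS hm)
  have hI := congrArg QuaternionAlgebra.imI h
  have hJ := congrArg QuaternionAlgebra.imJ h
  have hK := congrArg QuaternionAlgebra.imK h
  simp only [re_mul, imI_mul, imJ_mul, imK_mul, re_neg, re_one, hre] at hsq hI hJ hK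
  ext
  · simp [hre]
  · simp [hre]
    linear_combination q.imI * hsq + m.imK / 2 * hJ - m.imJ / 2 * hK
  · simp [hre]
    linear_combination q.imJ * hsq - m.imK / 2 * hI + m.imI / 2 * hK
  · simp [hre]
    linear_combination q.imK * hsq + m.imJ / 2 * hI - m.imI / 2 * hJ

theorem exists_ne_zero_anticommute {m : Hq} (hm : m ∈ QS) :
    ∃ j : Hq, j ≠ 0 ∧ m * j = -(j * m) := by
  by_contra! hcon
  have hcomm : ∀ p : Hq, m * p = p * m := fun p => by
    by_contra hp
    refine hcon (m * p - p * m) (sub_ne_zero.2 hp) ?_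
    have h := mul_self_of_mem_QS hm
    simp only [mul_sub, sub_mul, mul_assoc, h]
    simp only [← mul_assoc, h, neg_mul, one_mul, mul_neg, mul_one]
    abel
  have hre : m.re = 0 := by
    have := congrArg QuaternionAlgebra.re hm.1
    simp only [re_star, re_neg] at this
    linarith
  have hJ : ∀ p, (m * p).imJ = (p * m).imJ := fun p => by rw [hcomm]
  have hK : ∀ p, (m * p).imK = (p * m).imK := fun p => by rw [hcomm]
  simp only [imJ_mul, imK_mul] at hJ hK
  have hJi := hJ ⟨0, 1, 0, 0⟩
  have hKi := hK ⟨0, 1, 0, 0⟩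
  have hKj := hK ⟨0, 0, 1, 0⟩
  dsimp only at hJi hKi hKj
  have : m = 0 := by
    ext <;> simp only [re_zero, imI_zero, imJ_zero, imK_zero] <;> linarith
  have hnorm := hm.2
  simp [this] at hnorm

end Quaternion

section QuaternionicSpace

theorem rsmul_apply (q : Hq) (x : Hsp) (n : ℕ) : rsmul q x n = x n * q := rfl

theorem rsmul_rsmul (p q : Hq) (x : Hsp) : rsmul p (rsmul q x) = rsmul (q * p) x := by
  ext1
  funext n
  simp only [rsmul_apply, mul_assoc]

theorem rsmul_add (q : Hq) (x y : Hsp) : rsmul q (x + y) = rsmul q x + rsmul q y :=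
  smul_add _ _ _

theorem rsmul_neg (q : Hq) (x : Hsp) : rsmul q (-x) = -rsmul q x :=
  smul_neg _ _

theorem neg_rsmul (q : Hq) (x : Hsp) : rsmul (-q) x = -rsmul q x := by
  ext1
  funext n
  simp [rsmul_apply]

theorem add_rsmul (p q : Hq) (x : Hsp) : rsmul (p + q) x = rsmul p x + rsmul q x := by
  ext1
  funext n
  simp [rsmul_apply, mul_add]

theorem rsmul_one (x : Hsp) : rsmul 1 x = x := by
  ext1
  funext n
  simp [rsmul_apply]

theorem rsmul_coe (a : ℝ) (x : Hsp) : rsmul (a : Hq) x = a • x := by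
  ext1
  funext n
  simp [rsmul_apply, Quaternion.mul_coe_eq_smul]

theorem rsmul_smul (q : Hq) (a : ℝ) (x : Hsp) : rsmul q (a • x) = a • rsmul q x := by
  ext1
  funext n
  simp [rsmul_apply]

/-- Right multiplication by a quaternion as a real linear map. -/
def rsmulLinear (q : Hq) : Hsp →ₗ[ℝ] Hsp where
  toFun := rsmul q
  map_add' := rsmul_add q
  map_smul' := rsmul_smul q

theorem continuous_rsmul (q : Hq) : Continuous (rsmul q) :=
  continuous_const_smul (MulOpposite.op q)

theorem summable_star_mul (x y : Hsp) : Summable fun n => star (x n) * y n := by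
  have hs : ∀ z : Hsp, Summable fun n => ‖z n‖ ^ 2 := fun z => by
    simpa using (lp.memℓp z).summable (by norm_num)
  refine Summable.of_norm_bounded ((hs x).add (hs y)) fun n => ?_
  rw [norm_mul, norm_star]
  nlinarith [sq_nonneg (‖x n‖ - ‖y n‖), sq_nonneg (‖x n‖ + ‖y n‖)]

theorem qinner_re (x y : Hsp) : (qinner x y).re = inner ℝ x y := by
  rw [lp.inner_eq_tsum]
  have h : HasSum (fun n => (star (x n) * y n).re) (qinner x y).re :=
    (summable_star_mul x y).hasSum.map
      (show Hq →ₗ[ℝ] ℝ from QuaternionAlgebra.reₗ _ _ _) Quaternion.continuous_re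
  refine h.tsum_eq.symm.trans ?_
  refine tsum_congr fun n => ?_
  simp only [Quaternion.inner_def, Quaternion.re_mul,
    Quaternion.re_star, Quaternion.imI_star, Quaternion.imJ_star, Quaternion.imK_star]
  ring

theorem qinner_rsmul_right (q : Hq) (x y : Hsp) : qinner x (rsmul q y) = qinner x y * q := by
  simp only [qinner, rsmul_apply, ← mul_assoc]
  exact tsum_mul_right

theorem qinner_rsmul_left (q : Hq) (x y : Hsp) :
    qinner (rsmul q x) y = star q * qinner x y := by
  simp only [qinner, rsmul_apply, star_mul, mul_assoc]
  exact tsum_mul_left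

theorem qinner_neg_left (x y : Hsp) : qinner (-x) y = -qinner x y := by
  simp only [qinner, lp.coeFn_neg, Pi.neg_apply, star_neg, neg_mul]
  exact tsum_neg

theorem inner_rsmul_rsmul {m : Hq} (hm : m ∈ QS) (x y : Hsp) :
    inner ℝ (rsmul m x) (rsmul m y) = inner ℝ x y := by
  rw [← qinner_re, ← qinner_re, qinner_rsmul_left, qinner_rsmul_right,
    Quaternion.re_mul_comm, mul_assoc, hm.1, mul_neg, Quaternion.mul_self_of_mem_QS hm,
    neg_neg, mul_one]

theorem eq_of_qinner_left_eq {x y : Hsp} (h : ∀ z, qinner x z = qinner y z) : x = y :=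
  ext_inner_right ℝ fun z => by rw [← qinner_re, ← qinner_re, h]

instance : TopologicalSpace.SeparableSpace Hsp := by
  let s : Set Hsp := ⋃ n : ℕ, Set.range fun q : Hq => (lp.single 2 n q : Hsp)
  have hs : TopologicalSpace.IsSeparable s :=
    .iUnion fun n => TopologicalSpace.isSeparable_range
      (lp.isometry_single (E := fun _ : ℕ => Hq) (p := 2) n).continuous
  rw [← TopologicalSpace.isSeparable_univ_iff]
  refine (hs.span (R := ℝ)).closure.mono fun x _ => ?_
  refine mem_closure_of_tendsto (lp.hasSum_single ENNReal.ofNat_ne_top x) (.of_forall fun t => ?_)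
  exact Submodule.sum_mem _ fun n _ => Submodule.subset_span
    (Set.mem_iUnion.2 ⟨n, Set.mem_range_self _⟩)

theorem not_finiteDimensional_Hsp : ¬ FiniteDimensional ℝ Hsp := fun _ => by
  have hon : Orthonormal ℝ fun n : ℕ => (lp.single 2 n (1 : Hq) : Hsp) := by
    rw [orthonormal_iff_ite]
    intro r s
    rw [lp.inner_single_left]
    by_cases h : r = s
    · subst h
      simp
    · simp [h, lp.single_apply]
  exact not_finite_iff_infinite.2 inferInstance hon.linearIndependent.finite

/-- The slice Hilbert space `H₊^{Jm}` as a real subspace of `H`. -/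
def HplusSubmodule (J : Hsp → Hsp) (hJ : IsBoundedRightLinear J) (m : Hq) :
    Submodule ℝ Hsp where
  carrier := Hplus J m
  add_mem' {x y} hx hy := by
    simp only [Hplus, Set.mem_ofPred_eq] at *
    rw [hJ.1, rsmul_add, hx, hy]
  zero_mem' := ((AddMonoidHom.mk' J hJ.1).map_zero).trans (map_zero (rsmulLinear m)).symm
  smul_mem' a x hx := by
    simp only [Hplus, Set.mem_ofPred_eq] at *
    rw [rsmul_smul, ← rsmul_coe, hJ.2.1, hx, rsmul_coe]

variable {J : Hsp → Hsp} {m : Hq}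

theorem isClosed_Hplus (hJ : IsBoundedRightLinear J) : IsClosed (Hplus J m) := by
  obtain ⟨M, hM⟩ := hJ.2.2
  have hcont : Continuous J :=
    AddMonoidHomClass.continuous_of_bound (AddMonoidHom.mk' J hJ.1) M hM
  exact isClosed_eq hcont (continuous_rsmul m)

theorem rsmul_mem_Hplus (hJ : IsBoundedRightLinear J) {x : Hsp} (hx : x ∈ Hplus J m) :
    rsmul m x ∈ Hplus J m := by
  simp only [Hplus, Set.mem_ofPred_eq] at *
  rw [hJ.2.1, hx]

theorem qinner_eq_of_mem_Hplus (hm : m ∈ QS) (hJa : IsAntiSelfAdjoint J) {x y : Hsp}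
    (hx : x ∈ Hplus J m) (hy : y ∈ Hplus J m) :
    qinner x y = ((inner ℝ x y : ℝ) : Hq) + m * ((inner ℝ (rsmul m x) y : ℝ) : Hq) := by
  have h : qinner x (J y) = qinner (-(J x)) y := hJa y x
  rw [show J y = rsmul m y from hy, show J x = rsmul m x from hx, qinner_neg_left,
    qinner_rsmul_left, qinner_rsmul_right, hm.1, neg_mul, neg_neg] at h
  rw [← qinner_re, ← qinner_re, qinner_rsmul_left]
  exact Quaternion.eq_re_add_mul_of_commute hm h.symm

theorem map_map_eq_neg (hJ : IsBoundedRightLinear J) (hJa : IsAntiSelfAdjoint J)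
    (hJu : IsUnitaryOp J) (x : Hsp) : J (J x) = -x := by
  obtain ⟨S, hS, -, hJS⟩ := hJu
  have hSJ : S x = -J x := eq_of_qinner_left_eq fun z => by rw [← hS, ← hJa]
  have hneg : J (-J x) = -J (J x) := (AddMonoidHom.mk' J hJ.1).map_neg _
  rw [← neg_eq_iff_eq_neg, ← hneg, ← hSJ, hJS]

/-- Every vector splits as `x = u + v j` with `u, v ∈ H₊^{Jm}`, where `j` anticommutes
with `m`. -/
theorem exists_mem_Hplus_add_rsmul (hm : m ∈ QS) (hJ : IsBoundedRightLinear J)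
    (hJJ : ∀ x, J (J x) = -x) {j : Hq} (hj : j ≠ 0) (hmj : m * j = -(j * m)) (x : Hsp) :
    ∃ u ∈ Hplus J m, ∃ v ∈ Hplus J m, u + rsmul j v = x := by
  have hneg : ∀ y, J (-y) = -J y := (AddMonoidHom.mk' J hJ.1).map_neg
  have hsmul : ∀ (a : ℝ) y, J (a • y) = a • J y := fun a y => by
    rw [← rsmul_coe, hJ.2.1, rsmul_coe]
  have hmm : ∀ y, rsmul m (rsmul m y) = -y := fun y => by
    rw [rsmul_rsmul, Quaternion.mul_self_of_mem_QS hm, neg_rsmul, rsmul_one]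
  have hjm : j⁻¹ * m = -(m * j⁻¹) := by
    rw [inv_mul_eq_iff_eq_mul₀ hj, mul_neg, ← mul_assoc, ← neg_mul, ← hmj, mul_assoc,
      mul_inv_cancel₀ hj, mul_one]
  refine ⟨(1 / 2 : ℝ) • (x + -rsmul m (J x)), ?_,
    rsmul j⁻¹ ((1 / 2 : ℝ) • (x + rsmul m (J x))), ?_, ?_⟩
  · simp only [Hplus, Set.mem_ofPred_eq, hsmul, hJ.1, hneg, hJ.2.1, hJJ, rsmul_smul, rsmul_add,
      rsmul_neg, hmm, neg_neg]
    rw [add_comm]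
  · simp only [Hplus, Set.mem_ofPred_eq]
    rw [hJ.2.1, rsmul_rsmul, hjm, neg_rsmul, ← rsmul_rsmul, ← rsmul_neg]
    congr 1
    simp only [hsmul, hJ.1, hJ.2.1, hJJ, rsmul_smul, rsmul_add, rsmul_neg, hmm, ← smul_neg]
    congr 1
    abel
  · rw [rsmul_rsmul, inv_mul_cancel₀ hj, rsmul_one, ← smul_add]
    module

theorem not_finiteDimensional_HplusSubmodule (hm : m ∈ QS) (hJ : IsBoundedRightLinear J)
    (hJJ : ∀ x, J (J x) = -x) : ¬ FiniteDimensional ℝ (HplusSubmodule J hJ m) := fun _ => by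
  obtain ⟨j, hj, hmj⟩ := Quaternion.exists_ne_zero_anticommute hm
  let K := HplusSubmodule J hJ m
  refine not_finiteDimensional_Hsp (Module.Finite.of_surjective
    (K.subtype.coprod (rsmulLinear j ∘ₗ K.subtype)) fun x => ?_)
  obtain ⟨u, hu, v, hv, h⟩ := exists_mem_Hplus_add_rsmul hm hJ hJJ hj hmj x
  exact ⟨(⟨u, hu⟩, ⟨v, hv⟩), h⟩

end QuaternionicSpace

/-- The slice Hilbert space `H₊^{Jm}` is separable: it has a countable
orthonormal basis. -/
theorem slice_hilbert_space_separable (J : Hsp → Hsp) (m : Hq) (hm : m ∈ QS)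
    (hJlin : IsBoundedRightLinear J) (hJa : IsAntiSelfAdjoint J) (hJu : IsUnitaryOp J) :
    ∃ e : ℕ → Hsp, IsONBasisOn (Hplus J m) e := by
  let K := HplusSubmodule J hJlin m
  have : CompleteSpace K := (isClosed_Hplus hJlin).completeSpace_coe
  obtain ⟨e, he, he', hsum⟩ := exists_unitary_basis_of_complexStructure (E := K)
    ((rsmulLinear m).restrict fun x hx => rsmul_mem_Hplus hJlin hx)
    (fun x => Subtype.ext <| by
      change rsmul m (rsmul m x) = -(x : Hsp)
      rw [rsmul_rsmul, Quaternion.mul_self_of_mem_QS hm, neg_rsmul, rsmul_one])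
    (fun x y => inner_rsmul_rsmul hm x y)
    (not_finiteDimensional_HplusSubmodule hm hJlin (map_map_eq_neg hJlin hJa hJu))
  refine ⟨fun r => e r, fun r => (e r).2, fun r s => ?_, fun x hx => ?_⟩
  · have h₁ : inner ℝ (e r : Hsp) (e s) = if r = s then 1 else 0 := he r s
    have h₂ : inner ℝ (rsmul m (e r)) (e s : Hsp) = 0 := he' r s
    rw [qinner_eq_of_mem_Hplus hm hJa (e r).2 (e s).2, h₁, h₂]
    split_ifs <;> simp
  · refine ((hsum ⟨x, hx⟩).mapL K.subtypeL).congr_fun fun r => ?_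
    rw [qinner_eq_of_mem_Hplus hm hJa (e r).2 hx, add_rsmul, ← rsmul_rsmul, rsmul_coe, rsmul_coe]
    rfl
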